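/- Let F : H → H be a bounded linear operator with operator norm ‖F‖ ≤ 1, let ε ≥ 0, and assume the data (w_k)_{|k|∞ ≤ K} is orthonormal (⟨w_k, w_ℓ⟩ = 1 if k = ℓ and 0 otherwise) and satisfies ‖w_k − F e_k‖ ≤ ε for every |k|∞ ≤ K. Let T be the corresponding estimator. Then for every integer q ≥ 1 and every ψ ∈ H such that F^j ψ ∈ H^s for all 0 ≤ j ≤ q−1, one has ‖T^q ψ − F^q ψ‖ ≤ (ε · γ_K + K^{−s}) · ∑_{j=0}^{q−1} ‖F^j ψ‖_{H^s}. -/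

import Mathlib

open scoped ComplexInnerProductSpace
open Finset

noncomputable section

/-- The cube of lattice points `k ∈ ℤ^d` with sup norm `|k|∞ ≤ K`. -/
def cube (d K : ℕ) : Finset (Fin d → ℤ) :=
  Fintype.piFinset fun _ => Finset.Icc (-(K : ℤ)) (K : ℤ)

/-- The Sobolev weight `(1 + |k|₂²)^s`. -/
def weight (d : ℕ) (s : ℝ) (k : Fin d → ℤ) : ℝ :=
  (1 + ∑ i, ((k i : ℝ)) ^ 2) ^ s

variable {H : Type*} [NormedAddCommGroup H] [InnerProductSpace ℂ H] [CompleteSpace H]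

/-- The estimator `T = ∑_{|k|∞ ≤ K} w_k ⊗ e_k`, i.e. `T u = ∑_{|k|∞ ≤ K} ⟨u, e_k⟩ w_k`
(with the Mathlib convention that `⟪·,·⟫` is linear in the second argument, so the paper
inner product `⟨u, e_k⟩` is `⟪e k, u⟫`). -/
def estimator {d : ℕ} (e : HilbertBasis (Fin d → ℤ) ℂ H)
    (w : (Fin d → ℤ) → H) (K : ℕ) : H →L[ℂ] H :=
  ∑ k ∈ cube d K, (innerSL ℂ (e k)).smulRight (w k)

/-- The Sobolev norm `‖ψ‖_{H^s}`. -/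
def sobolevNorm {d : ℕ} (s : ℝ) (e : HilbertBasis (Fin d → ℤ) ℂ H) (ψ : H) : ℝ :=
  Real.sqrt (∑' k, weight d s k * ‖⟪e k, ψ⟫‖ ^ 2)

/-- Membership in the Sobolev space `H^s`. -/
def memSobolev {d : ℕ} (s : ℝ) (e : HilbertBasis (Fin d → ℤ) ℂ H) (ψ : H) : Prop :=
  Summable fun k => weight d s k * ‖⟪e k, ψ⟫‖ ^ 2

/-- `γ_K = (∑_{|k|∞ ≤ K} (1+|k|₂²)^{-s})^{1/2}`. -/
def gammaK (d : ℕ) (s : ℝ) (K : ℕ) : ℝ :=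
  Real.sqrt (∑ k ∈ cube d K, (weight d s k)⁻¹)

section OneStep

variable {d : ℕ}

theorem weight_pos (s : ℝ) (k : Fin d → ℤ) : 0 < weight d s k :=
  Real.rpow_pos_of_pos (by positivity) s

theorem rpow_sq_le_weight {K : ℕ} {s : ℝ} (hs : 0 < s) {k : Fin d → ℤ} (hk : k ∉ cube d K) :
    ((K : ℝ) ^ s) ^ 2 ≤ weight d s k := by
  obtain ⟨i, hi⟩ : ∃ i, k i ∉ Finset.Icc (-(K : ℤ)) (K : ℤ) := by
    simpa [cube, Fintype.mem_piFinset] using hk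
  have hKi : (K : ℤ) ≤ |k i| := by
    by_contra! h
    exact hi (Finset.mem_Icc.2 (abs_le.1 h.le))
  have hsq : (K : ℝ) ^ 2 ≤ (k i : ℝ) ^ 2 := by
    rw [← sq_abs (k i : ℝ)]
    have : (K : ℝ) ≤ |(k i : ℝ)| := by exact_mod_cast hKi
    gcongr
  have hsum : (k i : ℝ) ^ 2 ≤ ∑ i, (k i : ℝ) ^ 2 :=
    Finset.single_le_sum (f := fun i => (k i : ℝ) ^ 2) (fun _ _ => sq_nonneg _)
      (Finset.mem_univ i)
  rw [← Real.rpow_natCast, ← Real.rpow_mul (by positivity), mul_comm, Real.rpow_mul (by positivity),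
    Real.rpow_natCast]
  exact Real.rpow_le_rpow (by positivity) (by linarith) hs.le

omit [CompleteSpace H] in
theorem estimator_apply (e : HilbertBasis (Fin d → ℤ) ℂ H) (w : (Fin d → ℤ) → H) (K : ℕ) (u : H) :
    estimator e w K u = ∑ k ∈ cube d K, ⟪e k, u⟫ • w k := by
  simp [estimator]

omit [CompleteSpace H] in
theorem norm_estimator_apply_le {K : ℕ} (e : HilbertBasis (Fin d → ℤ) ℂ H) {w : (Fin d → ℤ) → H}
    (hw : ∀ k ∈ cube d K, ∀ l ∈ cube d K, ⟪w k, w l⟫ = if k = l then 1 else 0) (u : H) :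
    ‖estimator e w K u‖ ≤ ‖u‖ := by
  have hsq : (‖estimator e w K u‖ : ℂ) ^ 2 = ((∑ k ∈ cube d K, ‖⟪e k, u⟫‖ ^ 2 : ℝ) : ℂ) := by
    refine (inner_self_eq_norm_sq_to_K (𝕜 := ℂ) (estimator e w K u)).symm.trans ?_
    rw [estimator_apply, sum_inner]
    push_cast
    refine Finset.sum_congr rfl fun k hk => ?_
    rw [inner_sum, Finset.sum_eq_single_of_mem k hk]
    · rw [inner_smul_left, inner_smul_right, hw k hk k hk, if_pos rfl, mul_one, RCLike.conj_mul]
      rfl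
    · intro l hl hlk
      rw [inner_smul_left, inner_smul_right, hw k hk l hl, if_neg hlk.symm, mul_zero, mul_zero]
  have hsq' : ‖estimator e w K u‖ ^ 2 = ∑ k ∈ cube d K, ‖⟪e k, u⟫‖ ^ 2 := by exact_mod_cast hsq
  refine le_of_sq_le_sq ?_ (norm_nonneg _)
  rw [hsq']
  exact e.orthonormal.sum_inner_products_le u

omit [CompleteSpace H] in
theorem HilbertBasis.hasSum_norm_inner_sq {ι : Type*} (e : HilbertBasis ι ℂ H) (u : H) :
    HasSum (fun k => ‖⟪e k, u⟫‖ ^ 2) (‖u‖ ^ 2) := by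
  have h := Complex.hasSum_re (e.hasSum_inner_mul_inner u u)
  have hre : (⟪u, u⟫).re = ‖u‖ ^ 2 := inner_self_eq_norm_sq (𝕜 := ℂ) u
  rw [hre] at h
  refine h.congr_fun fun k => ?_
  rw [← inner_conj_symm u, Complex.conj_mul']
  norm_cast

omit [CompleteSpace H] in
theorem inner_sub_estimator_basis (e : HilbertBasis (Fin d → ℤ) ℂ H)
    (K : ℕ) (u : H) (k : Fin d → ℤ) :
    ⟪e k, u - estimator e e K u⟫ = if k ∈ cube d K then 0 else ⟪e k, u⟫ := by
  rw [estimator_apply, inner_sub_right, inner_sum]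
  simp [inner_smul_right, orthonormal_iff_ite.1 e.orthonormal, Finset.sum_ite_eq]
  split_ifs <;> simp

omit [CompleteSpace H] in
theorem norm_sub_estimator_basis_le {K : ℕ} (hK : 1 ≤ K) {s : ℝ} (hs : 0 < s)
    (e : HilbertBasis (Fin d → ℤ) ℂ H) {u : H} (hu : memSobolev s e u) :
    ‖u - estimator e e K u‖ ≤ (K : ℝ) ^ (-s) * sobolevNorm s e u := by
  have hpos : 0 < (K : ℝ) ^ s := Real.rpow_pos_of_pos (by exact_mod_cast hK) s
  rw [Real.rpow_neg (Nat.cast_nonneg K), inv_mul_eq_div, le_div_iff₀ hpos]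
  refine Real.le_sqrt_of_sq_le ?_
  rw [mul_pow]
  refine hasSum_le (fun k => ?_) ((e.hasSum_norm_inner_sq _).mul_right _) hu.hasSum
  rw [inner_sub_estimator_basis]
  split_ifs with hk
  · simpa using mul_nonneg (weight_pos s k).le (sq_nonneg ‖⟪e k, u⟫‖)
  · rw [mul_comm]
    exact mul_le_mul_of_nonneg_right (rpow_sq_le_weight hs hk) (sq_nonneg _)

omit [CompleteSpace H] in
theorem sum_norm_inner_le (K : ℕ) {s : ℝ} (e : HilbertBasis (Fin d → ℤ) ℂ H) {u : H}
    (hu : memSobolev s e u) :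
    ∑ k ∈ cube d K, ‖⟪e k, u⟫‖ ≤ gammaK d s K * sobolevNorm s e u := by
  have hnonneg (k : Fin d → ℤ) : 0 ≤ weight d s k * ‖⟪e k, u⟫‖ ^ 2 :=
    mul_nonneg (weight_pos s k).le (sq_nonneg _)
  calc ∑ k ∈ cube d K, ‖⟪e k, u⟫‖
      = ∑ k ∈ cube d K, √(weight d s k)⁻¹ * √(weight d s k * ‖⟪e k, u⟫‖ ^ 2) := by
        refine Finset.sum_congr rfl fun k _ => ?_
        rw [← Real.sqrt_mul (inv_nonneg.2 (weight_pos s k).le),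
          inv_mul_cancel_left₀ (weight_pos s k).ne', Real.sqrt_sq (norm_nonneg _)]
    _ ≤ √(∑ k ∈ cube d K, (weight d s k)⁻¹) * √(∑ k ∈ cube d K, weight d s k * ‖⟪e k, u⟫‖ ^ 2) :=
        Real.sum_sqrt_mul_sqrt_le _ (fun k => inv_nonneg.2 (weight_pos s k).le) hnonneg
    _ ≤ gammaK d s K * sobolevNorm s e u :=
        mul_le_mul_of_nonneg_left
          (Real.sqrt_le_sqrt (hu.sum_le_tsum _ fun k _ => hnonneg k)) (Real.sqrt_nonneg _)

omit [CompleteSpace H] in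
theorem norm_estimator_sub_le {K : ℕ} (hK : 1 ≤ K) {s : ℝ} (hs : 0 < s)
    (e : HilbertBasis (Fin d → ℤ) ℂ H) {F : H →L[ℂ] H} (hF : ‖F‖ ≤ 1) {ε : ℝ} (hε : 0 ≤ ε)
    {w : (Fin d → ℤ) → H} (hw : ∀ k ∈ cube d K, ‖w k - F (e k)‖ ≤ ε) {u : H}
    (hu : memSobolev s e u) :
    ‖estimator e w K u - F u‖ ≤ (ε * gammaK d s K + (K : ℝ) ^ (-s)) * sobolevNorm s e u := by
  have hsplit : estimator e w K u - F u
      = ∑ k ∈ cube d K, ⟪e k, u⟫ • (w k - F (e k)) - F (u - estimator e e K u) := by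
    simp only [estimator_apply, map_sub, map_sum, map_smul, smul_sub, Finset.sum_sub_distrib]
    abel
  have hdata : ‖∑ k ∈ cube d K, ⟪e k, u⟫ • (w k - F (e k))‖
      ≤ ε * (gammaK d s K * sobolevNorm s e u) :=
    calc ‖∑ k ∈ cube d K, ⟪e k, u⟫ • (w k - F (e k))‖
        ≤ ∑ k ∈ cube d K, ε * ‖⟪e k, u⟫‖ := by
          refine norm_sum_le_of_le _ fun k hk => ?_
          rw [norm_smul, mul_comm]
          exact mul_le_mul_of_nonneg_right (hw k hk) (norm_nonneg _)
      _ ≤ ε * (gammaK d s K * sobolevNorm s e u) := by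
          rw [← Finset.mul_sum]
          exact mul_le_mul_of_nonneg_left (sum_norm_inner_le K e hu) hε
  have htail : ‖F (u - estimator e e K u)‖ ≤ (K : ℝ) ^ (-s) * sobolevNorm s e u :=
    (F.le_of_opNorm_le hF _).trans
      ((one_mul _).trans_le (norm_sub_estimator_basis_le hK hs e hu))
  rw [hsplit]
  linarith [norm_sub_le (∑ k ∈ cube d K, ⟪e k, u⟫ • (w k - F (e k)))
    (F (u - estimator e e K u))]

end OneStep

/-- time generalization bound
`‖T^q ψ − F^q ψ‖ ≤ (ε γ_K + K^{−s}) ∑_{j<q} ‖F^j ψ‖_{H^s}`. -/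
theorem time_generalization_bound {d K : ℕ} (hd : 1 ≤ d) (hK : 1 ≤ K) {s : ℝ} (hs : 0 < s)
    (e : HilbertBasis (Fin d → ℤ) ℂ H) (F : H →L[ℂ] H) (hF : ‖F‖ ≤ 1)
    (ε : ℝ) (hε : 0 ≤ ε) (w : (Fin d → ℤ) → H)
    (hw_on : ∀ k ∈ cube d K, ∀ l ∈ cube d K, ⟪w k, w l⟫ = if k = l then 1 else 0)
    (hw_close : ∀ k ∈ cube d K, ‖w k - F (e k)‖ ≤ ε)
    (q : ℕ) (hq : 1 ≤ q) (ψ : H) (hψ : ∀ j < q, memSobolev s e ((F ^ j) ψ)) :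
    ‖(estimator e w K ^ q) ψ - (F ^ q) ψ‖
      ≤ (ε * gammaK d s K + (K : ℝ) ^ (-s))
          * ∑ j ∈ Finset.range q, sobolevNorm s e ((F ^ j) ψ) := by
  clear hq
  induction q with
  | zero => simp
  | succ q ih =>
    have hstep : (estimator e w K ^ (q + 1)) ψ - (F ^ (q + 1)) ψ
        = estimator e w K ((estimator e w K ^ q) ψ - (F ^ q) ψ)
          + (estimator e w K ((F ^ q) ψ) - F ((F ^ q) ψ)) := by
      rw [pow_succ', pow_succ' F, map_sub]
      simp only [mul_apply_eq_comp]
      abel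
    rw [hstep, Finset.sum_range_succ, mul_add]
    exact norm_add_le_of_le
      ((norm_estimator_apply_le e hw_on _).trans (ih fun j hj => hψ j (hj.trans q.lt_succ_self)))
      (norm_estimator_sub_le hK hs e hF hε hw_close (hψ q q.lt_succ_self))
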